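/- Let (W,S) be a Coxeter system. The assignment u ↦ P^u extends to a ℤ-algebra isomorphism from the Coxeter monoid algebra ℤ[W^M] onto the subalgebra of End(V_W) generated by {P^{{s}} : s ∈ S} together with the identity. -/

import Mathlib

open CoxeterSystem

variable {B W : Type*} [Group W] {M : CoxeterMatrix B}

/-- The projection `P^{{s}}` onto `W^{{s}}`: removes a trailing `s` if that shortens `w`. -/
noncomputable def CoxeterSystem.projSimple (cs : CoxeterSystem M W) (s : B) (w : W) : W :=
  if cs.length (w * cs.simple s) < cs.length w then w * cs.simple s else w

/-- For a word `ω = s₁ ⋯ s_k`, the composition `P^{{s₁}} ∘ ⋯ ∘ P^{{s_k}}`. -/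
noncomputable def CoxeterSystem.projWord (cs : CoxeterSystem M W) (ω : List B) : W → W :=
  ω.foldr (fun s g => cs.projSimple s ∘ g) id

/-- The Bruhat order, via the subword property: `u ≤ v` iff some reduced word for `v`
has a subword whose product is `u`. -/
def CoxeterSystem.bruhatLE (cs : CoxeterSystem M W) (u v : W) : Prop :=
  ∃ ω : List B, cs.IsReduced ω ∧ cs.wordProd ω = v ∧
    ∃ ω' : List B, ω'.Sublist ω ∧ cs.wordProd ω' = u

/-- The defining relations of the Coxeter monoid: idempotence of the generators and
the braid relations. -/
inductive coxMonoidRel (M : CoxeterMatrix B) : FreeMonoid B → FreeMonoid B → Prop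
  | idem (s : B) : coxMonoidRel M (FreeMonoid.of s * FreeMonoid.of s) (FreeMonoid.of s)
  | braid (s t : B) (h : M s t ≠ 0) :
      coxMonoidRel M (FreeMonoid.ofList (alternatingWord s t (M s t)))
        (FreeMonoid.ofList (alternatingWord t s (M s t)))

/-- The Coxeter monoid `W^M` of the Coxeter matrix `M`. -/
def CoxeterMonoid (M : CoxeterMatrix B) := PresentedMonoid (coxMonoidRel M)

instance (M : CoxeterMatrix B) : Monoid (CoxeterMonoid M) :=
  inferInstanceAs (Monoid (PresentedMonoid (coxMonoidRel M)))

namespace CoxeterSystem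

/-! ### The exchange property -/

open Classical in
/-- The action of a simple reflection on `W × ZMod 2` by conjugation on the first factor, changing
the sign exactly at that reflection. -/
noncomputable def signedConj (cs : CoxeterSystem M W) (i : B) : Function.End (W × ZMod 2) :=
  fun p => (cs.simple i * p.1 * cs.simple i, p.2 + if p.1 = cs.simple i then 1 else 0)

open Classical in
theorem prod_signedConj (cs : CoxeterSystem M W) (ω : List B) (p : W × ZMod 2) :
    (ω.map cs.signedConj).prod p =
      (cs.wordProd ω * p.1 * (cs.wordProd ω)⁻¹, p.2 + (cs.rightInvSeq ω).count p.1) := by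
  induction ω with
  | nil => simp; rfl
  | cons i ω ih =>
    rw [List.map_cons, List.prod_cons]
    change cs.signedConj i ((ω.map cs.signedConj).prod p) = _
    rw [ih]
    have key : cs.wordProd ω * p.1 * (cs.wordProd ω)⁻¹ = cs.simple i ↔
        (cs.wordProd ω)⁻¹ * cs.simple i * cs.wordProd ω = p.1 := by
      constructor
      · intro h; rw [← h]; group
      · intro h; rw [← h]; group
    simp only [signedConj, key, wordProd_cons, rightInvSeq, List.count_cons, beq_iff_eq]
    simp only [mul_inv_rev, inv_simple, mul_assoc, Nat.cast_add, Nat.cast_ite, Nat.cast_one,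
      Nat.cast_zero, add_assoc]

theorem map_alternatingWord_prod {N : Type*} [Monoid N] (f : B → N) (i j : B) (m : ℕ) :
    ((alternatingWord i j (2 * m)).map f).prod = (f i * f j) ^ m := by
  induction m with
  | zero => simp [alternatingWord]
  | succ m ih =>
    rw [show 2 * (m + 1) = 2 * m + 1 + 1 by ring, alternatingWord_succ', alternatingWord_succ']
    simp [ih, pow_succ', mul_assoc, parity_simps]

theorem rightInvSeq_eq_leftInvSeq (cs : CoxeterSystem M W) {ω : List B}
    (h : cs.wordProd ω = 1) : cs.rightInvSeq ω = cs.leftInvSeq ω := by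
  apply List.ext_getElem (by simp)
  intro k h₁ h₂
  rw [length_rightInvSeq] at h₁
  rw [getElem_rightInvSeq _ _ _ h₁, getElem_leftInvSeq _ _ _ h₁]
  have hω : cs.wordProd (ω.take k) * cs.simple ω[k] * cs.wordProd (ω.drop (k + 1)) = 1 := by
    rw [← h, mul_assoc, ← wordProd_cons, ← List.drop_eq_getElem_cons, ← wordProd_append,
      List.take_append_drop]
  rw [List.getElem?_eq_getElem h₁, Option.map_some, Option.getD_some,
    eq_inv_of_mul_eq_one_right hω]
  simp [mul_assoc]

theorem signedConj_isLiftable (cs : CoxeterSystem M W) : M.IsLiftable cs.signedConj := by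
  classical
  intro i j
  have h1 : cs.wordProd (alternatingWord i j (2 * M i j)) = 1 := by
    rw [wordProd, map_alternatingWord_prod, simple_mul_simple_pow]
  rw [← map_alternatingWord_prod]
  funext p
  rw [prod_signedConj, h1, cs.rightInvSeq_eq_leftInvSeq h1]
  set L := cs.leftInvSeq (alternatingWord i j (2 * M i j)) with hL
  have hlen : L.length = 2 * M i j := by simp [hL]
  have hper : L.take (M i j) = L.drop (M i j) := by
    apply List.ext_getElem
    · simp [hlen]; omega
    · intro k h₁ h₂
      simp only [List.length_take, List.length_drop, hlen] at h₁ h₂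
      rw [List.getElem_take, List.getElem_drop]
      simp only [hL]
      rw [getElem_leftInvSeq_alternatingWord _ _ _ _ _ (by omega),
        getElem_leftInvSeq_alternatingWord _ _ _ _ _ (by omega),
        prod_alternatingWord_eq_mul_pow, prod_alternatingWord_eq_mul_pow]
      rw [show (2 * (M i j + k) + 1) / 2 = M j i + k by rw [M.symmetric]; omega,
        show (2 * k + 1) / 2 = k by omega, pow_add, simple_mul_simple_pow]
      simp [parity_simps]
  have hc : L.count p.1 = 2 * (L.drop (M i j)).count p.1 := by
    conv_lhs => rw [← List.take_append_drop (M i j) L, List.count_append, hper]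
    ring
  have h2 : ((2 : ℕ) : ZMod 2) = 0 := by decide
  rw [hc, Nat.cast_mul, h2]
  simp
  rfl

open Classical in
theorem count_rightInvSeq_eq (cs : CoxeterSystem M W) {ω ω' : List B}
    (h : cs.wordProd ω = cs.wordProd ω') (t : W) :
    ((cs.rightInvSeq ω).count t : ZMod 2) = (cs.rightInvSeq ω').count t := by
  have key (ν : List B) :
      cs.lift ⟨cs.signedConj, cs.signedConj_isLiftable⟩ (cs.wordProd ν) =
        (ν.map cs.signedConj).prod := by
    simp only [wordProd, map_list_prod, List.map_map]
    congr 2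
    funext i
    exact cs.lift_apply_simple _ i
  have := congrArg Prod.snd (congrFun ((key ω).symm.trans ((congrArg _ h).trans (key ω'))) (t, 0))
  simpa [prod_signedConj] using this

/-- The exchange property. -/
theorem IsRightDescent.exists_eraseIdx {cs : CoxeterSystem M W} {ω : List B} {i : B}
    (h : cs.IsRightDescent (cs.wordProd ω) i) :
    ∃ j < ω.length, cs.wordProd ω * cs.simple i = cs.wordProd (ω.eraseIdx j) := by
  classical
  obtain ⟨ν, hν, hνw⟩ := cs.exists_isReduced (cs.wordProd ω * cs.simple i)
  have hprod : cs.wordProd ω = cs.wordProd (ν.concat i) := by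
    rw [wordProd_concat, ← hνw, simple_mul_simple_cancel_right]
  have hnot : cs.simple i ∉ cs.rightInvSeq ν := by
    intro hmem
    have := (cs.isRightInversion_of_mem_rightInvSeq hν hmem).2
    rw [← hνw, simple_mul_simple_cancel_right] at this
    exact lt_asymm h this
  have hcount : (cs.rightInvSeq (ν.concat i)).count (cs.simple i) = 1 := by
    rw [rightInvSeq_concat, List.concat_eq_append, List.count_append, List.count_singleton_self,
      List.count_eq_zero.2]
    intro hmem
    obtain ⟨x, hx, hxi⟩ := List.mem_map.1 hmem
    have : x = cs.simple i := by
      rw [MulAut.conj_apply, inv_simple] at hxi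
      have := congrArg (fun y => cs.simple i * y * cs.simple i) hxi
      simpa [mul_assoc] using this
    exact hnot (this ▸ hx)
  have hmem : cs.simple i ∈ cs.rightInvSeq ω := by
    by_contra hn
    have := cs.count_rightInvSeq_eq hprod (cs.simple i)
    rw [hcount, List.count_eq_zero.2 hn] at this
    exact absurd this (by decide)
  obtain ⟨j, hj, hji⟩ := List.mem_iff_getElem.1 hmem
  refine ⟨j, by simpa using hj, ?_⟩
  rw [← hji, ← List.getD_eq_getElem _ 1 hj, wordProd_mul_getD_rightInvSeq]

end CoxeterSystem

namespace CoxeterSystem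

/-! ### The order of a product of two simple reflections -/

/-- A complex number whose square has multiplicative order `m` (infinite order if `m = 0`). -/
noncomputable def rootParam (m : ℕ) : ℂ :=
  if m = 0 then 2 else Complex.exp (Real.pi * Complex.I / m)

theorem rootParam_ne_zero (m : ℕ) : rootParam m ≠ 0 := by
  unfold rootParam
  split_ifs
  · norm_num
  · exact Complex.exp_ne_zero _

theorem isPrimitiveRoot_rootParam_sq {m : ℕ} (hm : m ≠ 0) :
    IsPrimitiveRoot (rootParam m ^ 2) m := by
  rw [rootParam, if_neg hm, ← Complex.exp_nat_mul]
  convert Complex.isPrimitiveRoot_exp m hm using 2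
  push_cast
  ring

theorem dvd_of_rootParam_sq_pow {m k : ℕ} (h : (rootParam m ^ 2) ^ k = 1) : m ∣ k := by
  by_cases hm : m = 0
  · subst hm
    rw [rootParam, if_pos rfl, ← pow_mul] at h
    have h' : (2 : ℕ) ^ (2 * k) = 1 := by exact_mod_cast h
    have : 2 * k = 0 := by simpa using h'
    simp; omega
  · exact (isPrimitiveRoot_rootParam_sq hm).dvd_of_pow_eq_one _ h

theorem rootParam_one : rootParam 1 = -1 := by
  simp [rootParam, Complex.exp_pi_mul_I]

end CoxeterSystem

namespace CoxeterMatrix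

open Module CoxeterSystem

/-- The simple coroots of a complex reflection representation of the Coxeter group of `M`. -/
noncomputable def coroot (M : CoxeterMatrix B) (i : B) : Dual ℂ (B →₀ ℂ) :=
  Finsupp.linearCombination ℂ fun j => -(rootParam (M i j) + (rootParam (M i j))⁻¹)

/-- The reflection associated with a simple root. -/
noncomputable def rootReflection (M : CoxeterMatrix B) (i : B) : End ℂ (B →₀ ℂ) :=
  preReflection (Finsupp.single i 1) (M.coroot i)

theorem coroot_single (M : CoxeterMatrix B) (i j : B) :
    M.coroot i (Finsupp.single j 1) = -(rootParam (M i j) + (rootParam (M i j))⁻¹) := by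
  simp [coroot]

theorem coroot_single_self (M : CoxeterMatrix B) (i : B) :
    M.coroot i (Finsupp.single i 1) = 2 := by
  rw [coroot_single, M.diagonal, rootParam_one]
  norm_num

theorem rootReflection_apply (M : CoxeterMatrix B) (i : B) (z : B →₀ ℂ) :
    M.rootReflection i z = z - M.coroot i z • Finsupp.single i 1 :=
  preReflection_apply _ _ _

theorem rootReflection_mul_apply_eigenvector (M : CoxeterMatrix B) (i j : B) {q : ℂ}
    (hq : q ≠ 0) (hqM : q + q⁻¹ = rootParam (M i j) + (rootParam (M i j))⁻¹) :
    (M.rootReflection i * M.rootReflection j) (Finsupp.single i 1 + q⁻¹ • Finsupp.single j 1) =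
      q ^ 2 • (Finsupp.single i 1 + q⁻¹ • Finsupp.single j 1) := by
  simp only [End.mul_apply, rootReflection_apply, map_add, map_sub, map_smul, coroot_single_self]
  simp only [coroot_single, M.symmetric j i, ← hqM]
  match_scalars <;> field_simp <;> ring

theorem rootReflection_mul_pow_apply (M : CoxeterMatrix B) (i j : B) (n : ℕ) (a b z₁ z₂ : ℂ)
    (u v z : B →₀ ℂ)
    (hu : (M.rootReflection i * M.rootReflection j) u = z₁ • u)
    (hv : (M.rootReflection i * M.rootReflection j) v = z₂ • v)
    (hz : (M.rootReflection i * M.rootReflection j) z = z + a • u + b • v) :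
    ((M.rootReflection i * M.rootReflection j) ^ n) z =
      z + (a * ∑ k ∈ Finset.range n, z₁ ^ k) • u + (b * ∑ k ∈ Finset.range n, z₂ ^ k) • v := by
  induction n with
  | zero => simp
  | succ n ih =>
    rw [pow_succ', End.mul_apply, ih, map_add, map_add, map_smul, map_smul, hu, hv, hz,
      Finset.sum_range_succ', Finset.sum_range_succ']
    simp only [pow_succ, ← Finset.sum_mul]
    match_scalars <;> ring

theorem rootReflection_isLiftable (M : CoxeterMatrix B) : M.IsLiftable M.rootReflection := by
  intro i j
  by_cases hij : i = j
  · subst hij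
    rw [M.diagonal, pow_one]
    refine LinearMap.ext fun z => ?_
    exact involutive_preReflection (M.coroot_single_self i) z
  by_cases hm : M i j = 0
  · rw [hm, pow_zero]
  have hm1 : 1 < M i j := by
    have := M.off_diagonal i j hij
    omega
  set q := rootParam (M i j) with hq
  have hq0 : q ≠ 0 := rootParam_ne_zero _
  have hprim : IsPrimitiveRoot (q ^ 2) (M i j) := isPrimitiveRoot_rootParam_sq hm
  have hprim' : IsPrimitiveRoot (q⁻¹ ^ 2) (M i j) := by
    rw [inv_pow]; exact hprim.inv
  have hne : q ^ 2 - 1 ≠ 0 := sub_ne_zero.2 (hprim.ne_one hm1)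
  have hu := M.rootReflection_mul_apply_eigenvector i j hq0 rfl
  have hv := M.rootReflection_mul_apply_eigenvector i j (inv_ne_zero hq0)
    (by rw [inv_inv, add_comm])
  refine LinearMap.ext fun y => ?_
  have hy : (M.rootReflection i * M.rootReflection j) y = y +
      ((-q ^ 2 * (M.coroot i y + (q + q⁻¹) * M.coroot j y) + q * M.coroot j y) / (q ^ 2 - 1)) •
        (Finsupp.single i 1 + q⁻¹ • Finsupp.single j 1) +
      (((M.coroot i y + (q + q⁻¹) * M.coroot j y) - q * M.coroot j y) / (q ^ 2 - 1)) •
        (Finsupp.single i 1 + q⁻¹⁻¹ • Finsupp.single j 1) := by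
    simp only [End.mul_apply, rootReflection_apply, map_sub, map_smul, coroot_single, ← hq]
    match_scalars <;> field_simp <;> ring
  have := M.rootReflection_mul_pow_apply i j (M i j) _ _ _ _ _ _ _ hu hv hy
  rw [hprim.geom_sum_eq_zero hm1, hprim'.geom_sum_eq_zero hm1] at this
  simpa using this

end CoxeterMatrix

namespace CoxeterSystem

/-- The order of a product of two simple reflections is divisible by the entry of the Coxeter
matrix. -/
theorem dvd_of_simple_mul_simple_pow (cs : CoxeterSystem M W) {i j : B} {k : ℕ}
    (h : (cs.simple i * cs.simple j) ^ k = 1) : M i j ∣ k := by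
  by_cases hij : i = j
  · subst hij; simp
  have h1 := congrArg (cs.lift ⟨M.rootReflection, M.rootReflection_isLiftable⟩) h
  rw [map_pow, map_mul, lift_apply_simple, lift_apply_simple, map_one] at h1
  set v : B →₀ ℂ := Finsupp.single i 1 + (rootParam (M i j))⁻¹ • Finsupp.single j 1 with hv
  have heig := M.rootReflection_mul_apply_eigenvector i j (rootParam_ne_zero (M i j)) rfl
  have hpow (n : ℕ) : ((M.rootReflection i * M.rootReflection j) ^ n) v =
      ((rootParam (M i j) ^ 2) ^ n) • v := by
    induction n with
    | zero => simp
    | succ n ih => rw [pow_succ, Module.End.mul_apply, heig, map_smul, ih, smul_smul, ← pow_succ']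
  have h2 := hpow k
  rw [h1] at h2
  have h3 := DFunLike.congr_fun h2 i
  apply dvd_of_rootParam_sq_pow
  simpa [hv, Finsupp.single_apply, Ne.symm hij] using h3.symm

end CoxeterSystem

namespace CoxeterSystem

/-! ### Minimal coset representatives of standard parabolic subgroups -/

/-- `v` has minimal length in its left coset of the standard parabolic subgroup of `J`. -/
def IsCosetMin (cs : CoxeterSystem M W) (J : Set B) (v : W) : Prop :=
  ∀ x : List B, (∀ b ∈ x, b ∈ J) → cs.length v ≤ cs.length (v * cs.wordProd x)

theorem exists_isCosetMin (cs : CoxeterSystem M W) (J : Set B) (w : W) :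
    ∃ v, cs.IsCosetMin J v ∧ ∃ y : List B, (∀ b ∈ y, b ∈ J) ∧ w = v * cs.wordProd y := by
  induction hn : cs.length w using Nat.strong_induction_on generalizing w with
  | _ n ih =>
    by_cases h : cs.IsCosetMin J w
    · exact ⟨w, h, [], by simp, by simp⟩
    · simp only [IsCosetMin, not_forall, not_le] at h
      obtain ⟨x, hx, hlt⟩ := h
      obtain ⟨v, hv, y, hy, hw⟩ := ih _ (hn ▸ hlt) _ rfl
      refine ⟨v, hv, y ++ x.reverse, ?_, ?_⟩
      · intro b hb
        rcases List.mem_append.1 hb with hb | hb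
        · exact hy b hb
        · exact hx b (List.mem_reverse.1 hb)
      · rw [wordProd_append, wordProd_reverse, ← mul_assoc, ← hw, mul_inv_cancel_right]

theorem length_wordProd_eraseIdx_le (cs : CoxeterSystem M W) {ω : List B} {j : ℕ}
    (hj : j < ω.length) : cs.length (cs.wordProd (ω.eraseIdx j)) + 1 ≤ ω.length := by
  have := cs.length_wordProd_le (ω.eraseIdx j)
  have := List.length_eraseIdx_add_one hj
  omega

theorem IsCosetMin.exists_word {cs : CoxeterSystem M W} {J : Set B} {v : W}
    (hv : cs.IsCosetMin J v) (y : List B) (hy : ∀ b ∈ y, b ∈ J) :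
    ∃ x : List B, (∀ b ∈ x, b ∈ J) ∧ cs.wordProd x = cs.wordProd y ∧
      cs.length (v * cs.wordProd y) = cs.length v + x.length := by
  induction y using List.reverseRecOn with
  | nil => exact ⟨[], by simp, rfl, by simp⟩
  | append_singleton y i ih =>
    have hi : i ∈ J := hy i (by simp)
    obtain ⟨x, hx, hxy, hlen⟩ := ih fun b hb => hy b (by simp [hb])
    have hmul : v * cs.wordProd (y ++ [i]) = v * cs.wordProd y * cs.simple i := by
      simp [wordProd_append, mul_assoc]
    rcases cs.length_mul_simple (v * cs.wordProd y) i with h | h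
    · refine ⟨x ++ [i], ?_, ?_, ?_⟩
      · simpa [or_imp, forall_and] using ⟨hx, hi⟩
      · simp [wordProd_append, hxy]
      · rw [hmul, h, hlen, List.length_append, List.length_singleton, add_assoc]
    · obtain ⟨ν, hν, rfl⟩ := cs.exists_isReduced v
      have hd : cs.IsRightDescent (cs.wordProd (ν ++ x)) i := by
        rw [wordProd_append, hxy, IsRightDescent]
        omega
      obtain ⟨j, hj, hjw⟩ := hd.exists_eraseIdx
      by_cases hjν : j < ν.length
      · exfalso
        rw [List.eraseIdx_append_of_lt_length hjν, wordProd_append, wordProd_append] at hjw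
        have h1 := hv (x ++ [i] ++ x.reverse) (by
          intro b hb
          simp only [List.mem_append, List.mem_singleton, List.mem_reverse] at hb
          rcases hb with (hb | rfl) | hb
          exacts [hx b hb, hi, hx b hb])
        have h2 : cs.wordProd ν * cs.wordProd (x ++ [i] ++ x.reverse) =
            cs.wordProd (ν.eraseIdx j) := by
          rw [wordProd_append, wordProd_append, wordProd_reverse, wordProd_singleton,
            ← mul_assoc, ← mul_assoc, hjw, mul_inv_cancel_right]
        rw [h2, hν.eq] at h1
        have := cs.length_wordProd_eraseIdx_le hjν
        omega
      · rw [not_lt] at hjν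
        rw [List.length_append] at hj
        rw [List.eraseIdx_append_of_length_le hjν, wordProd_append, wordProd_append, mul_assoc,
          mul_left_cancel_iff] at hjw
        refine ⟨x.eraseIdx (j - ν.length), fun b hb => hx b (List.mem_of_mem_eraseIdx hb), ?_, ?_⟩
        · rw [← hjw, hxy]
          simp [wordProd_append]
        · have := List.length_eraseIdx_add_one (show j - ν.length < x.length by omega)
          rw [hmul]
          omega

theorem isReduced_of_length_mul_eq (cs : CoxeterSystem M W) {v : W} {x : List B}
    (h : cs.length (v * cs.wordProd x) = cs.length v + x.length) : cs.IsReduced x := by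
  have h1 := cs.length_mul_le v (cs.wordProd x)
  have h2 := cs.length_wordProd_le x
  unfold IsReduced
  omega

theorem IsCosetMin.eq_of_forall_not_isRightDescent {cs : CoxeterSystem M W} {J : Set B} {v : W}
    (hv : cs.IsCosetMin J v) (y : List B) (hy : ∀ b ∈ y, b ∈ J)
    (h : ∀ i ∈ J, ¬cs.IsRightDescent (v * cs.wordProd y) i) : v * cs.wordProd y = v := by
  obtain ⟨x, hx, hxy, hlen⟩ := hv.exists_word y hy
  rcases List.eq_nil_or_concat x with rfl | ⟨x, i, rfl⟩
  · simp [← hxy]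
  · refine absurd ?_ (h i (hx i (by simp)))
    have h1 : v * cs.wordProd y * cs.simple i = v * cs.wordProd x := by
      simp [← hxy, wordProd_append, mul_assoc]
    have h2 := cs.length_mul_le v (cs.wordProd x)
    have h3 := cs.length_wordProd_le x
    rw [IsRightDescent, h1, hlen]
    simp
    omega

/-! ### Rank two parabolic subgroups -/

theorem not_isReduced_append_pair (cs : CoxeterSystem M W) (ω : List B) (i : B) :
    ¬cs.IsReduced (ω ++ [i] ++ [i]) := by
  intro h
  have h1 := cs.length_wordProd_le ω
  rw [IsReduced, wordProd_append, wordProd_append, wordProd_singleton,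
    simple_mul_simple_cancel_right] at h
  simp at h
  omega

theorem IsReduced.of_append_left {cs : CoxeterSystem M W} {ω ω' : List B}
    (h : cs.IsReduced (ω ++ ω')) : cs.IsReduced ω := by
  simpa using h.take ω.length

theorem IsReduced.eq_alternatingWord {cs : CoxeterSystem M W} {s t : B} {x : List B}
    (hx : cs.IsReduced x) (hst : ∀ b ∈ x, b = s ∨ b = t) :
    x = alternatingWord s t x.length ∨ x = alternatingWord t s x.length := by
  induction x using List.reverseRecOn with
  | nil => simp [alternatingWord]
  | append_singleton x i ih =>
    have ih := ih hx.of_append_left fun b hb => hst b (by simp [hb])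
    have hi := hst i (by simp)
    have key (a b : B) (h : x = alternatingWord a b x.length) :
        x ++ [a] = alternatingWord b a (x ++ [a]).length := by
      rw [List.length_append, List.length_singleton, alternatingWord_succ, ← h,
        List.concat_eq_append]
    have key' (a b : B) (h : x = alternatingWord a b x.length) (hib : i = b) :
        x ++ [i] = alternatingWord a b (x ++ [i]).length := by
      subst hib
      rcases Nat.eq_zero_or_eq_succ_pred x.length with h0 | h0
      · rw [List.length_eq_zero_iff.1 h0]
        simp [alternatingWord]
      · rw [h0, Nat.succ_eq_add_one, alternatingWord_succ, List.concat_eq_append] at h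
        rw [h] at hx
        exact absurd hx (cs.not_isReduced_append_pair _ _)
    rcases hi with rfl | rfl <;> rcases ih with ih | ih
    · exact .inr (key _ _ ih)
    · exact .inr (key' _ _ ih rfl)
    · exact .inl (key' _ _ ih rfl)
    · exact .inl (key _ _ ih)

theorem IsReduced.append_singleton_eq_alternatingWord {cs : CoxeterSystem M W} {s t : B}
    {x : List B} (hx : cs.IsReduced (x ++ [t])) (hst : ∀ b ∈ x ++ [t], b = s ∨ b = t) :
    x ++ [t] = alternatingWord s t (x ++ [t]).length := by
  rcases hx.eq_alternatingWord hst with h | h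
  · exact h
  · have h' := h
    rw [List.length_append, List.length_singleton, alternatingWord_succ, List.concat_eq_append,
      List.append_singleton_inj] at h'
    obtain ⟨-, rfl⟩ := h'
    exact h

theorem simple_mul_simple_pow_eq_one (cs : CoxeterSystem M W) {s t : B} {k : ℕ}
    (h : cs.wordProd (alternatingWord s t k) = cs.wordProd (alternatingWord t s k)) :
    (cs.simple s * cs.simple t) ^ k = 1 := by
  have hinv : cs.simple t * cs.simple s = (cs.simple s * cs.simple t)⁻¹ := by simp
  rw [prod_alternatingWord_eq_mul_pow, prod_alternatingWord_eq_mul_pow] at h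
  rcases Nat.even_or_odd' k with ⟨n, rfl | rfl⟩
  · simp only [even_two, Even.mul_right, if_true, one_mul, hinv] at h
    rw [show 2 * n / 2 = n by omega, inv_pow, eq_inv_iff_mul_eq_one, ← pow_add, ← two_mul] at h
    exact h
  · simp only [Nat.not_even_bit1, if_false, show (2 * n + 1) / 2 = n by omega] at h
    have h1 : (cs.simple s * cs.simple t) ^ n =
        cs.simple t * (cs.simple s * (cs.simple t * cs.simple s) ^ n) := by
      rw [← h, simple_mul_simple_cancel_left]
    rw [← mul_assoc, hinv, ← pow_succ', inv_pow, eq_inv_iff_mul_eq_one, ← pow_add] at h1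
    rw [← h1]
    congr 1
    omega

theorem IsReduced.alternatingWord_le {cs : CoxeterSystem M W} {s t : B} {k : ℕ}
    (h : cs.IsReduced (alternatingWord s t k)) (hM : M s t ≠ 0) : k ≤ M s t :=
  not_lt.1 fun hlt => cs.not_isReduced_alternatingWord s t hM hlt h

/-- An element with two distinct right descents ends in the corresponding braid word. -/
theorem exists_isReduced_append_alternatingWord (cs : CoxeterSystem M W) {w : W} {s t : B}
    (hs : cs.IsRightDescent w s) (ht : cs.IsRightDescent w t) :
    M s t ≠ 0 ∧ ∃ ν : List B, cs.IsReduced (ν ++ alternatingWord s t (M s t)) ∧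
      cs.wordProd (ν ++ alternatingWord s t (M s t)) = w := by
  obtain ⟨v, hv, y, hy, hw⟩ := cs.exists_isCosetMin {s, t} w
  have key (i : B) (hi : i ∈ ({s, t} : Set B)) (hd : cs.IsRightDescent w i) :
      ∃ x : List B, (∀ b ∈ x ++ [i], b = s ∨ b = t) ∧ v * cs.wordProd (x ++ [i]) = w ∧
        cs.length w = cs.length v + (x ++ [i]).length := by
    obtain ⟨x, hx, hxy, hlen⟩ := hv.exists_word (y ++ [i]) (by
      simpa [or_imp, forall_and] using ⟨hy, hi⟩)
    rw [wordProd_append, wordProd_singleton, ← mul_assoc, ← hw] at hlen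
    rw [isRightDescent_iff] at hd
    refine ⟨x, ?_, ?_, ?_⟩
    · simpa [or_imp, forall_and] using ⟨hx, hi⟩
    · rw [wordProd_append, hxy, wordProd_append, wordProd_singleton,
        simple_mul_simple_cancel_right, ← hw]
    · simp; omega
  obtain ⟨x, hx, hxw, hxl⟩ := key s (by simp) hs
  obtain ⟨x', hx', hxw', hxl'⟩ := key t (by simp) ht
  have hred := cs.isReduced_of_length_mul_eq (hxw ▸ hxl)
  have hred' := cs.isReduced_of_length_mul_eq (hxw' ▸ hxl')
  have halt := hred.append_singleton_eq_alternatingWord fun b hb => (hx b hb).symm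
  have halt' := hred'.append_singleton_eq_alternatingWord hx'
  have hk : (x ++ [s]).length = (x' ++ [t]).length := by omega
  rw [hk] at halt
  have hk0 : 0 < (x' ++ [t]).length := by simp
  generalize (x' ++ [t]).length = k at *
  rw [halt] at hxw hred
  rw [halt'] at hxw' hred'
  have hdvd := cs.dvd_of_simple_mul_simple_pow
    (cs.simple_mul_simple_pow_eq_one (mul_left_cancel (hxw'.trans hxw.symm)))
  have hM : M s t ≠ 0 := by
    intro h0
    rw [h0, zero_dvd_iff] at hdvd
    omega
  have hkM : k = M s t := le_antisymm (hred'.alternatingWord_le hM) (Nat.le_of_dvd hk0 hdvd)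
  subst hkM
  obtain ⟨ν, hν, rfl⟩ := cs.exists_isReduced v
  refine ⟨hM, ν, ?_, by rw [wordProd_append, hxw']⟩
  rw [IsReduced, wordProd_append, hxw', hxl', hν.eq, List.length_append, length_alternatingWord]

theorem IsReduced.append_alternatingWord_swap {cs : CoxeterSystem M W} {ν : List B} {s t : B}
    (h : cs.IsReduced (ν ++ alternatingWord s t (M s t))) :
    cs.IsReduced (ν ++ alternatingWord t s (M s t)) := by
  have := cs.wordProd_braidWord_eq s t
  rw [braidWord, braidWord, M.symmetric t s] at this
  rw [IsReduced, wordProd_append, this, ← wordProd_append] at h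
  rw [IsReduced, h]
  simp

end CoxeterSystem

namespace CoxeterMonoid

open CoxeterSystem

/-- The class of a word in the Coxeter monoid. -/
def ofWord (M : CoxeterMatrix B) (ω : List B) : CoxeterMonoid M :=
  PresentedMonoid.mk (coxMonoidRel M) (FreeMonoid.ofList ω)

theorem ofWord_append (M : CoxeterMatrix B) (ω ω' : List B) :
    ofWord M (ω ++ ω') = ofWord M ω * ofWord M ω' := by
  rw [ofWord, FreeMonoid.ofList_append]
  exact map_mul (PresentedMonoid.mk (coxMonoidRel M)) _ _

theorem ofWord_surjective (M : CoxeterMatrix B) : Function.Surjective (ofWord M) := fun x => by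
  obtain ⟨a, rfl⟩ := PresentedMonoid.surjective_mk (rels := coxMonoidRel M) x
  exact ⟨a.toList, rfl⟩

theorem ofWord_singleton_mul_self (M : CoxeterMatrix B) (i : B) :
    ofWord M [i] * ofWord M [i] = ofWord M [i] :=
  PresentedMonoid.mk_eq_mk_of_rel (coxMonoidRel.idem i)

theorem ofWord_alternatingWord (M : CoxeterMatrix B) {s t : B} (h : M s t ≠ 0) :
    ofWord M (alternatingWord s t (M s t)) = ofWord M (alternatingWord t s (M s t)) :=
  PresentedMonoid.mk_eq_mk_of_rel (coxMonoidRel.braid s t h)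

/-- Matsumoto's theorem. -/
theorem ofWord_eq_of_wordProd_eq (cs : CoxeterSystem M W) {ω ω' : List B}
    (hω : cs.IsReduced ω) (hω' : cs.IsReduced ω') (h : cs.wordProd ω = cs.wordProd ω') :
    ofWord M ω = ofWord M ω' := by
  induction hn : ω.length generalizing ω ω' with
  | zero =>
    have h' : ω'.length = 0 := by rw [← hω'.eq, ← h, hω.eq, hn]
    rw [List.length_eq_zero_iff.1 hn, List.length_eq_zero_iff.1 h']
  | succ n ih =>
    have hlast (x y : List B) (i : B) (hx : cs.IsReduced (x ++ [i])) (hy : cs.IsReduced (y ++ [i]))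
        (hxy : cs.wordProd (x ++ [i]) = cs.wordProd (y ++ [i])) (hl : (x ++ [i]).length = n + 1) :
        ofWord M (x ++ [i]) = ofWord M (y ++ [i]) := by
      rw [ofWord_append, ofWord_append, ih hx.of_append_left hy.of_append_left
        (by simpa [wordProd_append] using hxy) (by simpa using hl)]
    have hn' : ω'.length = n + 1 := by rw [← hω'.eq, ← h, hω.eq, hn]
    obtain rfl | ⟨α, s, rfl⟩ := List.eq_nil_or_concat' ω
    · simp at hn
    obtain rfl | ⟨β, t, rfl⟩ := List.eq_nil_or_concat' ω'
    · simp at hn'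
    have hdesc (x : List B) (i : B) (hx : cs.IsReduced (x ++ [i])) :
        cs.IsRightDescent (cs.wordProd (x ++ [i])) i := by
      rw [IsRightDescent, hx.eq, wordProd_append, wordProd_singleton,
        simple_mul_simple_cancel_right, hx.of_append_left.eq]
      simp
    have hs := hdesc α s hω
    have ht := hdesc β t hω'
    rw [← h] at ht
    obtain ⟨hM, ν, hν, hνw⟩ := cs.exists_isReduced_append_alternatingWord hs ht
    have hν' := hν.append_alternatingWord_swap
    have hνw' : cs.wordProd (ν ++ alternatingWord t s (M s t)) = cs.wordProd (α ++ [s]) := by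
      have := cs.wordProd_braidWord_eq s t
      rw [braidWord, braidWord, M.symmetric t s] at this
      rw [← hνw, wordProd_append, wordProd_append, this]
    have hswap : ofWord M (ν ++ alternatingWord s t (M s t)) =
        ofWord M (ν ++ alternatingWord t s (M s t)) := by
      rw [ofWord_append, ofWord_append, ofWord_alternatingWord M hM]
    obtain ⟨k, hk⟩ := Nat.exists_eq_succ_of_ne_zero hM
    rw [hk, Nat.succ_eq_add_one, alternatingWord_succ, alternatingWord_succ,
      List.concat_eq_append, List.concat_eq_append, ← List.append_assoc,
      ← List.append_assoc] at hswap
    rw [hk, Nat.succ_eq_add_one, alternatingWord_succ, List.concat_eq_append,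
      ← List.append_assoc] at hν hνw hν' hνw'
    rw [hlast _ _ s hω hν' hνw'.symm hn, ← hswap]
    refine (hlast _ _ t hω' hν (by rw [hνw, h]) hn').symm

theorem exists_isReduced_ofWord_eq (cs : CoxeterSystem M W) (x : CoxeterMonoid M) :
    ∃ ω : List B, cs.IsReduced ω ∧ ofWord M ω = x := by
  obtain ⟨ω, rfl⟩ := ofWord_surjective M x
  induction ω using List.reverseRecOn with
  | nil => exact ⟨[], by simp [CoxeterSystem.IsReduced], rfl⟩
  | append_singleton ω i ih =>
    obtain ⟨α, hα, hαω⟩ := ih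
    rw [ofWord_append, ← hαω]
    rcases cs.length_mul_simple (cs.wordProd α) i with h | h
    · refine ⟨α ++ [i], ?_, ofWord_append _ _ _⟩
      rw [CoxeterSystem.IsReduced, wordProd_append, wordProd_singleton, h, hα.eq]
      simp
    · obtain ⟨ν, hν, hνw⟩ := cs.exists_isReduced (cs.wordProd α * cs.simple i)
      have hprod : cs.wordProd (ν ++ [i]) = cs.wordProd α := by
        rw [wordProd_append, wordProd_singleton, ← hνw, simple_mul_simple_cancel_right]
      have hred : cs.IsReduced (ν ++ [i]) := by
        rw [CoxeterSystem.IsReduced, hprod, ← h, hνw, hν.eq]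
        simp
      refine ⟨ν ++ [i], hred, ?_⟩
      rw [ofWord_eq_of_wordProd_eq cs hα hred hprod.symm, ofWord_append, mul_assoc,
        ofWord_singleton_mul_self]

end CoxeterMonoid

namespace CoxeterSystem

/-! ### The projections -/

theorem projSimple_of_isRightDescent {cs : CoxeterSystem M W} {w : W} {i : B}
    (h : cs.IsRightDescent w i) : cs.projSimple i w = w * cs.simple i := if_pos h

theorem projSimple_of_not_isRightDescent {cs : CoxeterSystem M W} {w : W} {i : B}
    (h : ¬cs.IsRightDescent w i) : cs.projSimple i w = w := if_neg h

theorem not_isRightDescent_projSimple (cs : CoxeterSystem M W) (i : B) (w : W) :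
    ¬cs.IsRightDescent (cs.projSimple i w) i := by
  by_cases h : cs.IsRightDescent w i
  · rw [projSimple_of_isRightDescent h]
    exact (cs.isRightDescent_iff_not_isRightDescent_mul).1 h
  · rwa [projSimple_of_not_isRightDescent h]

theorem projSimple_projSimple (cs : CoxeterSystem M W) (i : B) (w : W) :
    cs.projSimple i (cs.projSimple i w) = cs.projSimple i w :=
  projSimple_of_not_isRightDescent (cs.not_isRightDescent_projSimple i w)

theorem projWord_cons (cs : CoxeterSystem M W) (i : B) (ω : List B) :
    cs.projWord (i :: ω) = cs.projSimple i ∘ cs.projWord ω := rfl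

theorem projWord_append (cs : CoxeterSystem M W) (ω ω' : List B) :
    cs.projWord (ω ++ ω') = cs.projWord ω ∘ cs.projWord ω' := by
  induction ω with
  | nil => rfl
  | cons i ω ih => rw [List.cons_append, projWord_cons, projWord_cons, ih, Function.comp_assoc]

theorem projWord_singleton (cs : CoxeterSystem M W) (i : B) :
    cs.projWord [i] = cs.projSimple i := rfl

theorem exists_sublist_projWord (cs : CoxeterSystem M W) (ω : List B) (w : W) :
    ∃ ν : List B, ν.Sublist ω ∧ cs.projWord ω w * cs.wordProd ν = w := by
  induction ω with
  | nil => exact ⟨[], .refl _, by simp [projWord]⟩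
  | cons i ω ih =>
    obtain ⟨ν, hν, hw⟩ := ih
    rw [projWord_cons, Function.comp_apply]
    by_cases h : cs.IsRightDescent (cs.projWord ω w) i
    · refine ⟨i :: ν, hν.cons_cons i, ?_⟩
      rw [projSimple_of_isRightDescent h, wordProd_cons, mul_assoc, simple_mul_simple_cancel_left,
        hw]
    · exact ⟨ν, hν.cons i, by rw [projSimple_of_not_isRightDescent h, hw]⟩

theorem IsReduced.projWord_wordProd {cs : CoxeterSystem M W} {ω : List B}
    (h : cs.IsReduced ω) : cs.projWord ω (cs.wordProd ω) = 1 := by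
  induction ω using List.reverseRecOn with
  | nil => simp [projWord]
  | append_singleton ω i ih =>
    have h' := h.of_append_left
    have hd : cs.IsRightDescent (cs.wordProd (ω ++ [i])) i := by
      rw [IsRightDescent, h.eq, wordProd_append, wordProd_singleton,
        simple_mul_simple_cancel_right, h'.eq]
      simp
    rw [projWord_append, Function.comp_apply, projWord_singleton, projSimple_of_isRightDescent hd,
      wordProd_append, wordProd_singleton, simple_mul_simple_cancel_right, ih h']

/-- If `ω` is reduced, `cs.wordProd ω` is the only element of length at least `ω.length` that
`cs.projWord ω` sends to `1`. -/
theorem eq_wordProd_of_projWord_eq_one (cs : CoxeterSystem M W) {ω : List B} {w : W}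
    (h : cs.projWord ω w = 1) (hw : ω.length ≤ cs.length w) : w = cs.wordProd ω := by
  obtain ⟨ν, hν, hνw⟩ := cs.exists_sublist_projWord ω w
  rw [h, one_mul] at hνw
  subst hνw
  rw [hν.eq_of_length_le (hw.trans (cs.length_wordProd_le ν))]

theorem exists_projSimple_eq_mul_wordProd (cs : CoxeterSystem M W) {J : Set B} {i : B}
    (hi : i ∈ J) (v : W) {y : List B} (hy : ∀ b ∈ y, b ∈ J) :
    ∃ y' : List B, (∀ b ∈ y', b ∈ J) ∧
      cs.projSimple i (v * cs.wordProd y) = v * cs.wordProd y' := by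
  by_cases h : cs.IsRightDescent (v * cs.wordProd y) i
  · refine ⟨y ++ [i], ?_, ?_⟩
    · simpa [or_imp, forall_and] using ⟨hy, hi⟩
    · rw [projSimple_of_isRightDescent h, wordProd_append, wordProd_singleton, mul_assoc]
  · exact ⟨y, hy, projSimple_of_not_isRightDescent h⟩

theorem IsCosetMin.length_projSimple_le {cs : CoxeterSystem M W} {s t : B} {v : W}
    (hv : cs.IsCosetMin {s, t} v) {y : List B} (hy : ∀ b ∈ y, b ∈ ({s, t} : Set B)) {n : ℕ}
    (hs : ¬cs.IsRightDescent (v * cs.wordProd y) s)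
    (hl : cs.length (v * cs.wordProd y) ≤ cs.length v + (n + 1)) :
    cs.length (cs.projSimple t (v * cs.wordProd y)) ≤ cs.length v + n := by
  by_cases ht : cs.IsRightDescent (v * cs.wordProd y) t
  · rw [projSimple_of_isRightDescent ht]
    rw [isRightDescent_iff] at ht
    omega
  · have := hv.eq_of_forall_not_isRightDescent y hy (by
      rintro i (rfl | rfl)
      exacts [hs, ht])
    rw [projSimple_of_not_isRightDescent ht, this]
    omega

theorem IsCosetMin.projWord_alternatingWord_of_length_le {cs : CoxeterSystem M W} {s t : B}
    {v : W} (hv : cs.IsCosetMin {s, t} v) {y : List B} (hy : ∀ b ∈ y, b ∈ ({s, t} : Set B))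
    {n : ℕ} (hs : ¬cs.IsRightDescent (v * cs.wordProd y) s)
    (hl : cs.length (v * cs.wordProd y) ≤ cs.length v + n) :
    cs.projWord (alternatingWord s t n) (v * cs.wordProd y) = v := by
  induction n generalizing s t y with
  | zero =>
    obtain ⟨x, -, hxy, hlen⟩ := hv.exists_word y hy
    have hx : x = [] := List.length_eq_zero_iff.1 (by omega)
    simp [alternatingWord, projWord, ← hxy, hx]
  | succ n ih =>
    have hle := hv.length_projSimple_le hy hs hl
    have hnd := cs.not_isRightDescent_projSimple t (v * cs.wordProd y)
    obtain ⟨y', hy', h⟩ := cs.exists_projSimple_eq_mul_wordProd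
      (show t ∈ ({s, t} : Set B) by simp) v hy
    rw [h] at hle hnd
    rw [alternatingWord_succ, List.concat_eq_append, projWord_append, Function.comp_apply,
      projWord_singleton, h]
    rw [Set.pair_comm] at hv hy'
    exact ih hv hy' hnd hle

theorem IsCosetMin.projWord_alternatingWord {cs : CoxeterSystem M W} {s t : B} {v : W}
    (hv : cs.IsCosetMin {s, t} v) {y : List B} (hy : ∀ b ∈ y, b ∈ ({s, t} : Set B))
    (hM : M s t ≠ 0) :
    cs.projWord (alternatingWord s t (M s t)) (v * cs.wordProd y) = v := by
  obtain ⟨k, hk⟩ := Nat.exists_eq_succ_of_ne_zero hM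
  obtain ⟨x, hx, hxy, hlen⟩ := hv.exists_word y hy
  have hle : cs.length (cs.projSimple t (v * cs.wordProd y)) ≤ cs.length v + k := by
    rw [← hxy] at hlen ⊢
    have hred := cs.isReduced_of_length_mul_eq hlen
    have halt := hred.eq_alternatingWord hx
    have hxk : x.length ≤ M s t := by
      rcases halt with h | h
      · rw [h] at hred
        exact hred.alternatingWord_le hM
      · rw [h] at hred
        rw [M.symmetric] at hM ⊢
        exact hred.alternatingWord_le hM
    by_cases ht : cs.IsRightDescent (v * cs.wordProd x) t
    · rw [projSimple_of_isRightDescent ht]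
      rw [isRightDescent_iff] at ht
      omega
    · rw [projSimple_of_not_isRightDescent ht, hlen]
      by_contra hlt
      have hxM : x.length = M s t := by omega
      apply ht
      have hprod : cs.wordProd x = cs.wordProd (alternatingWord s t (M s t)) := by
        rcases halt with h | h
        · rw [h, hxM]
        · have := cs.wordProd_braidWord_eq s t
          rw [braidWord, braidWord, M.symmetric t s] at this
          rw [h, hxM, this]
      have h1 : v * cs.wordProd x * cs.simple t = v * cs.wordProd (alternatingWord t s k) := by
        rw [hprod, hk, Nat.succ_eq_add_one, alternatingWord_succ, wordProd_concat, mul_assoc,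
          simple_mul_simple_cancel_right]
      have h2 := cs.length_mul_le v (cs.wordProd (alternatingWord t s k))
      have h3 := cs.length_wordProd_le (alternatingWord t s k)
      rw [length_alternatingWord] at h3
      rw [IsRightDescent, h1]
      omega
  have hnd := cs.not_isRightDescent_projSimple t (v * cs.wordProd y)
  obtain ⟨y', hy', h⟩ := cs.exists_projSimple_eq_mul_wordProd
    (show t ∈ ({s, t} : Set B) by simp) v hy
  rw [h] at hle hnd
  rw [hk, Nat.succ_eq_add_one, alternatingWord_succ, List.concat_eq_append, projWord_append,
    Function.comp_apply, projWord_singleton, h]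
  rw [Set.pair_comm] at hv hy'
  exact hv.projWord_alternatingWord_of_length_le hy' hnd hle

theorem projWord_alternatingWord_comm (cs : CoxeterSystem M W) {s t : B} (hM : M s t ≠ 0) :
    cs.projWord (alternatingWord s t (M s t)) = cs.projWord (alternatingWord t s (M s t)) := by
  funext w
  obtain ⟨v, hv, y, hy, rfl⟩ := cs.exists_isCosetMin {s, t} w
  rw [hv.projWord_alternatingWord hy hM]
  rw [Set.pair_comm] at hv hy
  rw [M.symmetric] at hM ⊢
  rw [hv.projWord_alternatingWord hy hM]

/-- The linearization of `cs.projWord ω`. -/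
noncomputable def linProjWord (cs : CoxeterSystem M W) (ω : List B) : Module.End ℤ (W →₀ ℤ) :=
  Finsupp.lmapDomain ℤ ℤ (cs.projWord ω)

theorem linProjWord_eq_lift (cs : CoxeterSystem M W) (ω : List B) :
    FreeMonoid.lift (fun i => cs.linProjWord [i]) (FreeMonoid.ofList ω) = cs.linProjWord ω := by
  induction ω with
  | nil => exact (Finsupp.lmapDomain_id ℤ ℤ).symm
  | cons i ω ih =>
    rw [FreeMonoid.ofList_cons, map_mul, ih, FreeMonoid.lift_eval_of]
    exact (Finsupp.lmapDomain_comp ℤ ℤ _ _).symm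

/-- The action of the Coxeter monoid on the free module on `W` by projections. -/
noncomputable def projHom (cs : CoxeterSystem M W) :
    CoxeterMonoid M →* Module.End ℤ (W →₀ ℤ) :=
  PresentedMonoid.lift (rels := coxMonoidRel M) (fun i => cs.linProjWord [i]) <| by
    rintro a b (i | ⟨s, t, h⟩)
    · have hi : FreeMonoid.of i * FreeMonoid.of i = FreeMonoid.ofList [i, i] := rfl
      rw [hi, ← FreeMonoid.ofList_singleton, linProjWord_eq_lift, linProjWord_eq_lift, linProjWord,
        linProjWord]
      congr 1
      funext w
      exact cs.projSimple_projSimple i w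
    · rw [linProjWord_eq_lift, linProjWord_eq_lift, linProjWord, linProjWord,
        cs.projWord_alternatingWord_comm h]

theorem projHom_ofWord (cs : CoxeterSystem M W) (ω : List B) :
    cs.projHom (CoxeterMonoid.ofWord M ω) = cs.linProjWord ω :=
  cs.linProjWord_eq_lift ω

theorem linProjWord_single (cs : CoxeterSystem M W) (ω : List B) (w : W) :
    cs.linProjWord ω (Finsupp.single w 1) = Finsupp.single (cs.projWord ω w) 1 :=
  Finsupp.mapDomain_single

/-- The linear extension of `projHom` to the Coxeter monoid algebra. -/
noncomputable def projAlgHom (cs : CoxeterSystem M W) :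
    MonoidAlgebra ℤ (CoxeterMonoid M) →ₐ[ℤ] Module.End ℤ (W →₀ ℤ) :=
  MonoidAlgebra.lift ℤ _ _ cs.projHom

theorem projAlgHom_injective (cs : CoxeterSystem M W) : Function.Injective cs.projAlgHom := by
  classical
  rw [injective_iff_map_eq_zero]
  intro a ha
  by_contra hne
  choose red hred hredx using CoxeterMonoid.exists_isReduced_ofWord_eq cs
  have hsupp : a.coeff.support.Nonempty := by
    rw [Finset.nonempty_iff_ne_empty]
    intro h
    exact hne (MonoidAlgebra.coeff_injective (Finsupp.support_eq_empty.1 h))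
  obtain ⟨x, hx, hmax⟩ := a.coeff.support.exists_max_image (fun y => (red y).length) hsupp
  have h1 := DFunLike.congr_fun (LinearMap.congr_fun ha
    (Finsupp.single (cs.wordProd (red x)) 1)) 1
  rw [projAlgHom, MonoidAlgebra.lift_apply, Finsupp.sum, LinearMap.sum_apply,
    Finsupp.finsetSum_apply, Finset.sum_eq_single x] at h1
  · rw [← hredx x, projHom_ofWord, hredx x, LinearMap.smul_apply, linProjWord_single,
      (hred x).projWord_wordProd] at h1
    exact Finsupp.mem_support_iff.1 hx (by simpa using h1)
  · intro y hy hyx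
    rw [← hredx y, projHom_ofWord, hredx y, LinearMap.smul_apply, linProjWord_single,
      Finsupp.smul_apply, Finsupp.single_apply, if_neg, smul_zero]
    intro hone
    apply hyx
    rw [← hredx y, ← hredx x]
    exact CoxeterMonoid.ofWord_eq_of_wordProd_eq cs (hred y) (hred x)
      (cs.eq_wordProd_of_projWord_eq_one hone (by rw [(hred x).eq]; exact hmax y hy)).symm
  · exact fun h => absurd hx h

theorem range_projAlgHom (cs : CoxeterSystem M W) :
    cs.projAlgHom.range = Algebra.adjoin ℤ (Set.range fun s : B =>
      (Finsupp.lmapDomain ℤ ℤ (cs.projSimple s) : Module.End ℤ (W →₀ ℤ))) := by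
  apply le_antisymm
  · rintro _ ⟨a, rfl⟩
    change cs.projAlgHom a ∈ _
    rw [projAlgHom, MonoidAlgebra.lift_apply]
    refine Subalgebra.sum_mem _ fun x _ => Subalgebra.smul_mem _ ?_ _
    obtain ⟨ω, rfl⟩ := CoxeterMonoid.ofWord_surjective M x
    rw [projHom_ofWord, ← linProjWord_eq_lift, FreeMonoid.lift_apply]
    refine Subalgebra.list_prod_mem _ fun y hy => ?_
    obtain ⟨i, -, rfl⟩ := List.mem_map.1 hy
    exact Algebra.subset_adjoin ⟨i, rfl⟩
  · rw [Algebra.adjoin_le_iff]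
    rintro _ ⟨i, rfl⟩
    refine ⟨MonoidAlgebra.of ℤ _ (CoxeterMonoid.ofWord M [i]), ?_⟩
    change cs.projAlgHom _ = _
    rw [projAlgHom, MonoidAlgebra.lift_of, projHom_ofWord]
    rfl

end CoxeterSystem

theorem stmt_14 (cs : CoxeterSystem M W) :
    ∃ e : MonoidAlgebra ℤ (CoxeterMonoid M) ≃ₐ[ℤ]
        (Algebra.adjoin ℤ
          (Set.range fun s : B => (Finsupp.lmapDomain ℤ ℤ (cs.projSimple s) :
            Module.End ℤ (W →₀ ℤ)))),
      ∀ ω : List B, cs.IsReduced ω →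
        (e (MonoidAlgebra.of ℤ (CoxeterMonoid M)
            (PresentedMonoid.mk (coxMonoidRel M) (FreeMonoid.ofList ω))) :
          Module.End ℤ (W →₀ ℤ)) =
        Finsupp.lmapDomain ℤ ℤ (cs.projWord ω) := by
  refine ⟨(AlgEquiv.ofInjective _ cs.projAlgHom_injective).trans
    (Subalgebra.equivOfEq _ _ cs.range_projAlgHom), fun ω _ => ?_⟩
  exact (MonoidAlgebra.lift_of cs.projHom (CoxeterMonoid.ofWord M ω)).trans (cs.projHom_ofWord ω)
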